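/- arXiv:2402.07749 — 5 statements merged into one kernel-verified Lean document; each statement's English description precedes it below -/
import Mathlib

section
/- Under Assumptions 1, 2 and 3, for every σ ∈ (0,∞] there exists a minimizer u_σ ∈ T_σ of E_σ over T_σ (i.e., E_σ(u_σ) = min_{v ∈ T_σ} E_σ(v)). Moreover, for every sequence σ_n → ∞ and any choice of minimizers u_{σ_n} ∈ T_{σ_n} of E_{σ_n}, there is a subsequence (not relabeled) and an element u_∞ ∈ T_∞ such that ‖u_{σ_n} − u_∞‖_{T0} → 0 as n → ∞ and u_∞ is a minimizer of E_∞ over T_∞. -/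
open Filter Topology ENNReal

noncomputable section

variable {T0 : Type*} [NormedAddCommGroup T0] [NormedSpace ℝ T0] [CompleteSpace T0]

/-- Weak convergence of a sequence lying in the subspace `S ⊆ T0` endowed with
the norm `N`, tested against all linear functionals on `T0` which are bounded on
`(S, N)`. -/
def WeakConvIn (S : Set T0) (N : T0 → ℝ) (v : ℕ → T0) (v0 : T0) : Prop :=
  ∀ f : T0 →ₗ[ℝ] ℝ, (∃ C : ℝ, ∀ u ∈ S, |f u| ≤ C * N u) →
    Tendsto (fun n => f (v n)) atTop (𝓝 (f v0))

/-- `(S, N)` is a linear subspace of `T0` on which `N` is a norm. -/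
structure IsNormedSubspace (S : Set T0) (N : T0 → ℝ) : Prop where
  zero_mem : (0 : T0) ∈ S
  add_mem : ∀ u v : T0, u ∈ S → v ∈ S → u + v ∈ S
  smul_mem : ∀ (c : ℝ) (u : T0), u ∈ S → c • u ∈ S
  nonneg : ∀ u ∈ S, 0 ≤ N u
  eq_zero_of : ∀ u ∈ S, N u = 0 → u = 0
  triangle : ∀ u ∈ S, ∀ v ∈ S, N (u + v) ≤ N u + N v
  norm_smul : ∀ (c : ℝ), ∀ u ∈ S, N (c • u) = |c| * N u

/-- The weak sequential compactness of norm-bounded sets, i.e. the property of a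
reflexive Banach space furnished by the Banach–Alaoglu/Eberlein–Šmulian theorems. -/
def WeakSeqCompactIn (S : Set T0) (N : T0 → ℝ) : Prop :=
  ∀ v : ℕ → T0, (∀ n, v n ∈ S) → (∃ C : ℝ, ∀ n, N (v n) ≤ C) →
    ∃ (w : T0) (φ : ℕ → ℕ), w ∈ S ∧ StrictMono φ ∧ WeakConvIn S N (v ∘ φ) w

/-- Extension `Ē` of an energy `E` defined on `S ⊆ T0` to all of `T0`, taking the
value `+∞` off `S`. -/
def Ebar (S : Set T0) (E : T0 → ℝ) (u : T0) : ℝ≥0∞ :=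
  haveI := Classical.dec (u ∈ S)
  if u ∈ S then ENNReal.ofReal (E u) else ⊤

/-- A sequence of (finite) parameters `σ_n ∈ (0,∞)` tending to `∞`. -/
def ToInf (σs : ℕ → ℝ≥0∞) : Prop :=
  (∀ n, 0 < σs n ∧ σs n ≠ ⊤) ∧ Tendsto σs atTop (𝓝 ⊤)

/-- The data of the parametrized family: for each `σ ∈ (0,∞]` (encoded in `ℝ≥0∞`,
with `σ = ⊤` corresponding to `σ = ∞`), the subspace `T_σ = S σ ⊆ T0`, its norm
`‖·‖_{T_σ} = N σ`, and the energy `E_σ = E σ`. -/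
structure Family (T0 : Type*) [NormedAddCommGroup T0] [NormedSpace ℝ T0] where
  S : ℝ≥0∞ → Set T0
  N : ℝ≥0∞ → T0 → ℝ
  E : ℝ≥0∞ → T0 → ℝ

namespace Family

variable (F : Family T0)

/-- Standing structural assumptions: for every `σ ∈ (0,∞]`, `(T_σ, ‖·‖_{T_σ})` is a
normed linear subspace of `T0` which is weakly sequentially compact on bounded sets
(the property of reflexive Banach spaces), and `E_σ : T_σ → [0,∞)` is sequentially
lower semicontinuous with respect to weak convergence in `T_σ`. -/
structure Basic : Prop where
  normed : ∀ σ : ℝ≥0∞, 0 < σ → IsNormedSubspace (F.S σ) (F.N σ)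
  reflexive : ∀ σ : ℝ≥0∞, 0 < σ → WeakSeqCompactIn (F.S σ) (F.N σ)
  nonneg : ∀ σ : ℝ≥0∞, 0 < σ → ∀ u ∈ F.S σ, 0 ≤ F.E σ u
  lsc : ∀ σ : ℝ≥0∞, 0 < σ → ∀ (v : ℕ → T0) (v0 : T0), (∀ n, v n ∈ F.S σ) →
    v0 ∈ F.S σ → WeakConvIn (F.S σ) (F.N σ) v v0 →
    ENNReal.ofReal (F.E σ v0) ≤ Filter.liminf (fun n => ENNReal.ofReal (F.E σ (v n))) atTop

/-- Assumption 1: uniform embedding of the `T_σ` into `T0`, and asymptotic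
compactness of uniformly bounded sequences, with limit points in `T_∞`. -/
structure A1 : Prop where
  embed : ∃ M1 : ℝ, 0 < M1 ∧ ∀ σ : ℝ≥0∞, 0 < σ → ∀ u ∈ F.S σ, M1 * ‖u‖ ≤ F.N σ u
  compact : ∀ σs : ℕ → ℝ≥0∞, ToInf σs → ∀ v : ℕ → T0, (∀ n, v n ∈ F.S (σs n)) →
    (∃ C : ℝ, ∀ n, F.N (σs n) (v n) ≤ C) →
    ((∃ (w : T0) (φ : ℕ → ℕ), StrictMono φ ∧
        Tendsto (fun n => v (φ n)) atTop (𝓝 w)) ∧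
      ∀ (w : T0) (φ : ℕ → ℕ), StrictMono φ →
        Tendsto (fun n => v (φ n)) atTop (𝓝 w) → w ∈ F.S ⊤)

/-- Assumption 2: continuity and coercivity of the energies, uniformly in `σ`. -/
structure A2 (p : ℝ) : Prop where
  continuity : ∃ φ : ℝ → ℝ → ℝ, Continuous (Function.uncurry φ) ∧
    ∀ σ : ℝ≥0∞, 0 < σ → ∀ u ∈ F.S σ, ∀ v ∈ F.S σ,
      |F.E σ u - F.E σ v| ≤ φ (F.N σ u) (F.N σ v) * F.N σ (u - v)
  coercive : ∃ α : ℝ, 0 < α ∧ ∃ ψ : ℝ → ℝ, Continuous ψ ∧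
    Tendsto (fun t => ψ t / t ^ p) atTop (𝓝 0) ∧
    ∀ σ : ℝ≥0∞, 0 < σ → ∀ u ∈ F.S σ, α * F.N σ u ^ p ≤ F.E σ u + ψ (F.N σ u)

/-- Assumption 3: Γ-convergence, in the strong topology of `T0`, of the extended
energies `Ē_σ` to `Ē_∞` as `σ → ∞`. -/
structure A3 : Prop where
  liminf_le : ∀ (v : T0) (σs : ℕ → ℝ≥0∞), ToInf σs → ∀ vs : ℕ → T0,
    Tendsto vs atTop (𝓝 v) →
    Ebar (F.S ⊤) (F.E ⊤) v ≤ Filter.liminf (fun n => Ebar (F.S (σs n)) (F.E (σs n)) (vs n)) atTop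
  recovery : ∀ (v : T0) (σs : ℕ → ℝ≥0∞), ToInf σs →
    ∃ vs : ℕ → T0, Tendsto vs atTop (𝓝 v) ∧
      Filter.limsup (fun n => Ebar (F.S (σs n)) (F.E (σs n)) (vs n)) atTop ≤
        Ebar (F.S ⊤) (F.E ⊤) v

/-- Structural assumptions on the finite-dimensional (Galerkin) subspaces
`W_{σ,h} ⊆ T_σ`, for `σ ∈ (0,∞]` and `h ∈ (0,h0]`: each is a linear subspace,
and for each `h` the span of `⋃_{σ ∈ (0,∞]} W_{σ,h}` is finite dimensional. -/
structure FEBasic (W : ℝ≥0∞ → ℝ → Set T0) (h0 : ℝ) : Prop where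
  h0_pos : 0 < h0
  subset : ∀ σ : ℝ≥0∞, 0 < σ → ∀ h ∈ Set.Ioc (0 : ℝ) h0, W σ h ⊆ F.S σ
  linear : ∀ σ : ℝ≥0∞, 0 < σ → ∀ h ∈ Set.Ioc (0 : ℝ) h0,
    (0 : T0) ∈ W σ h ∧ (∀ u ∈ W σ h, ∀ v ∈ W σ h, u + v ∈ W σ h) ∧
      ∀ (c : ℝ), ∀ u ∈ W σ h, c • u ∈ W σ h
  findim : ∀ h ∈ Set.Ioc (0 : ℝ) h0,
    FiniteDimensional ℝ (Submodule.span ℝ (⋃ σ ∈ Set.Ioi (0 : ℝ≥0∞), W σ h))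

/-- Assumption 4: approximation property of the subspaces `W_{σ,h}`, the
characterization of the limiting spaces `W_{∞,h}`, and the asymptotic
approximability of recovery sequences. -/
structure A4 (W : ℝ≥0∞ → ℝ → Set T0) (h0 : ℝ) : Prop where
  approx : ∀ σ : ℝ≥0∞, 0 < σ → ∀ u ∈ F.S σ, ∃ (hs : ℕ → ℝ) (us : ℕ → T0),
    (∀ n, hs n ∈ Set.Ioc (0 : ℝ) h0) ∧ Tendsto hs atTop (𝓝 0) ∧
    (∀ n, us n ∈ W σ (hs n)) ∧ Tendsto (fun n => F.N σ (u - us n)) atTop (𝓝 0)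
  limitSpace : ∀ h ∈ Set.Ioc (0 : ℝ) h0,
    W ⊤ h = F.S ⊤ ∩ ⋃ σ ∈ Set.Ioi (0 : ℝ≥0∞), W σ h
  asympApprox_pos : ∀ h ∈ Set.Ioc (0 : ℝ) h0, ∀ v ∈ W ⊤ h,
    ∀ σs : ℕ → ℝ≥0∞, ToInf σs →
    ∃ vs : ℕ → T0, (∀ n, vs n ∈ F.S (σs n)) ∧ Tendsto vs atTop (𝓝 v) ∧
      Tendsto (fun n => F.E (σs n) (vs n)) atTop (𝓝 (F.E ⊤ v)) ∧
      ∃ ws : ℕ → T0, (∀ n, ws n ∈ W (σs n) h) ∧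
        Tendsto (fun n => F.N (σs n) (ws n - vs n)) atTop (𝓝 0)
  asympApprox_zero : ∀ v ∈ F.S ⊤, ∀ (σs : ℕ → ℝ≥0∞) (hs : ℕ → ℝ), ToInf σs →
    (∀ n, hs n ∈ Set.Ioc (0 : ℝ) h0) → Tendsto hs atTop (𝓝 0) →
    ∃ vs : ℕ → T0, (∀ n, vs n ∈ F.S (σs n)) ∧ Tendsto vs atTop (𝓝 v) ∧
      Tendsto (fun n => F.E (σs n) (vs n)) atTop (𝓝 (F.E ⊤ v)) ∧
      ∃ ws : ℕ → T0, (∀ n, ws n ∈ W (σs n) (hs n)) ∧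
        Tendsto (fun n => F.N (σs n) (ws n - vs n)) atTop (𝓝 0)

end Family

theorem ToInf.comp_strictMono {σs : ℕ → ℝ≥0∞} (h : ToInf σs) {φ : ℕ → ℕ} (hφ : StrictMono φ) :
    ToInf (σs ∘ φ) :=
  ⟨fun n => h.1 (φ n), h.2.comp hφ.tendsto_atTop⟩

theorem Ebar_of_mem {T0 : Type*} {S : Set T0} {E : T0 → ℝ} {u : T0} (hu : u ∈ S) :
    Ebar S E u = ENNReal.ofReal (E u) := by
  simp [Ebar, hu]

theorem Ebar_of_notMem {T0 : Type*} {S : Set T0} {E : T0 → ℝ} {u : T0} (hu : u ∉ S) :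
    Ebar S E u = ⊤ := by
  simp [Ebar, hu]

/-- A minimizer of `E` over `S` minimizes the extension of `E`. -/
theorem Ebar_le_of_forall_le {T0 : Type*} {S : Set T0} {E : T0 → ℝ} {u : T0} (hu : u ∈ S)
    (hmin : ∀ v ∈ S, E u ≤ E v) (v : T0) : Ebar S E u ≤ Ebar S E v := by
  by_cases hv : v ∈ S
  · rw [Ebar_of_mem hu, Ebar_of_mem hv]
    exact ENNReal.ofReal_le_ofReal (hmin v hv)
  · rw [Ebar_of_notMem hv]
    exact le_top

namespace Family

section

variable {T0 : Type*} [NormedAddCommGroup T0] [NormedSpace ℝ T0] {F : Family T0} {p : ℝ}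

/-- Sublevel sets of the energies are norm bounded, uniformly in the parameter. -/
theorem A2.exists_norm_le_of_energy_le (h2 : F.A2 p) (hp : 1 < p) (M : ℝ) :
    ∃ C : ℝ, ∀ σ : ℝ≥0∞, 0 < σ → ∀ u ∈ F.S σ, F.E σ u ≤ M → F.N σ u ≤ C := by
  obtain ⟨α, hα, ψ, -, hψ, hcoer⟩ := h2.coercive
  obtain ⟨T, hT⟩ := eventually_atTop.1 (hψ.eventually_lt_const (half_pos hα))
  refine ⟨max (max T 1) (2 * M / α), fun σ hσ u hu hE => ?_⟩
  by_contra! hlt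
  obtain ⟨hlt1, hM⟩ := max_lt_iff.1 hlt
  obtain ⟨hTN, h1N⟩ := max_lt_iff.1 hlt1
  have hpos : 0 < F.N σ u ^ p := Real.rpow_pos_of_pos (by linarith) p
  have hψN : ψ (F.N σ u) < α / 2 * F.N σ u ^ p := (div_lt_iff₀ hpos).1 (hT _ hTN.le)
  have hpow : F.N σ u ≤ F.N σ u ^ p := Real.self_le_rpow_of_one_le h1N.le hp.le
  have hMα : 2 * M < F.N σ u * α := (div_lt_iff₀ hα).1 hM
  have hmul : α * F.N σ u ≤ α * F.N σ u ^ p := mul_le_mul_of_nonneg_left hpow hα.le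
  linarith [hcoer σ hσ u hu]

/-- The direct method: each energy of the family attains its minimum. -/
theorem exists_minimizer (hp : 1 < p) (hB : F.Basic) (h2 : F.A2 p) {σ : ℝ≥0∞} (hσ : 0 < σ) :
    ∃ u ∈ F.S σ, ∀ v ∈ F.S σ, F.E σ u ≤ F.E σ v := by
  have hne : (F.E σ '' F.S σ).Nonempty := ⟨_, 0, (hB.normed σ hσ).zero_mem, rfl⟩
  have hbdd : BddBelow (F.E σ '' F.S σ) := by
    refine ⟨0, ?_⟩
    rintro _ ⟨u, hu, rfl⟩
    exact hB.nonneg σ hσ u hu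
  obtain ⟨e, he_anti, he_tendsto, he_mem⟩ := exists_seq_tendsto_sInf hne hbdd
  choose v hvS hve using he_mem
  obtain ⟨C, hC⟩ := h2.exists_norm_le_of_energy_le hp (e 0)
  obtain ⟨w, φ, hw, hφ, hweak⟩ := hB.reflexive σ hσ v hvS
    ⟨C, fun n => hC σ hσ _ (hvS n) ((hve n).trans_le (he_anti (Nat.zero_le n)))⟩
  have hlim : Tendsto (fun n => ENNReal.ofReal (F.E σ ((v ∘ φ) n))) atTop
      (𝓝 (ENNReal.ofReal (sInf (F.E σ '' F.S σ)))) := by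
    simp only [Function.comp_apply, hve]
    exact ENNReal.tendsto_ofReal (he_tendsto.comp hφ.tendsto_atTop)
  have hle := hB.lsc σ hσ (v ∘ φ) w (fun n => hvS (φ n)) hw hweak
  rw [hlim.liminf_eq] at hle
  refine ⟨w, hw, fun u hu => ?_⟩
  have hinf : sInf (F.E σ '' F.S σ) ≤ F.E σ u := csInf_le hbdd ⟨u, hu, rfl⟩
  exact (ENNReal.ofReal_le_ofReal_iff (hB.nonneg σ hσ u hu)).1
    (hle.trans (ENNReal.ofReal_le_ofReal hinf))

/-- Energies of minimizers along `σ_n → ∞` are asymptotically bounded by any value of the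
limit energy. -/
theorem A3.limsup_minimizer_le (h3 : F.A3) {σs : ℕ → ℝ≥0∞} (hσs : ToInf σs) {us : ℕ → T0}
    (hus : ∀ n, us n ∈ F.S (σs n) ∧ ∀ v ∈ F.S (σs n), F.E (σs n) (us n) ≤ F.E (σs n) v) (v : T0) :
    limsup (fun n => Ebar (F.S (σs n)) (F.E (σs n)) (us n)) atTop ≤ Ebar (F.S ⊤) (F.E ⊤) v := by
  obtain ⟨vs, -, hvs⟩ := h3.recovery v σs hσs
  exact (limsup_le_limsup (Eventually.of_forall fun n =>
    Ebar_le_of_forall_le (hus n).1 (hus n).2 (vs n))).trans hvs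

/-- Any limit of minimizers along `σ_n → ∞` which lies in `T_∞` minimizes `E_∞`. -/
theorem A3.minimizer_of_tendsto (h3 : F.A3) (hB : F.Basic) {σs : ℕ → ℝ≥0∞} (hσs : ToInf σs)
    {us : ℕ → T0}
    (hus : ∀ n, us n ∈ F.S (σs n) ∧ ∀ v ∈ F.S (σs n), F.E (σs n) (us n) ≤ F.E (σs n) v)
    {w : T0} (hw : w ∈ F.S ⊤) (hlim : Tendsto us atTop (𝓝 w)) :
    ∀ v ∈ F.S ⊤, F.E ⊤ w ≤ F.E ⊤ v := by
  intro v hv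
  have hle := (h3.liminf_le w σs hσs us hlim).trans
    ((liminf_le_limsup).trans (h3.limsup_minimizer_le hσs hus v))
  rw [Ebar_of_mem hw, Ebar_of_mem hv] at hle
  exact (ENNReal.ofReal_le_ofReal_iff (hB.nonneg ⊤ ENNReal.zero_lt_top v hv)).1 hle

/-- Minimizers along `σ_n → ∞` eventually have bounded energy. -/
theorem A3.exists_eventually_energy_le (h3 : F.A3) (hB : F.Basic) {σs : ℕ → ℝ≥0∞}
    (hσs : ToInf σs) {us : ℕ → T0}
    (hus : ∀ n, us n ∈ F.S (σs n) ∧ ∀ v ∈ F.S (σs n), F.E (σs n) (us n) ≤ F.E (σs n) v) :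
    ∃ M : ℝ, ∀ᶠ n in atTop, F.E (σs n) (us n) ≤ M := by
  have h0 : (0 : T0) ∈ F.S ⊤ := (hB.normed ⊤ ENNReal.zero_lt_top).zero_mem
  have hnn : 0 ≤ F.E ⊤ 0 := hB.nonneg ⊤ ENNReal.zero_lt_top 0 h0
  have hlt : limsup (fun n => Ebar (F.S (σs n)) (F.E (σs n)) (us n)) atTop
      < ENNReal.ofReal (F.E ⊤ 0 + 1) := by
    refine (h3.limsup_minimizer_le hσs hus 0).trans_lt ?_
    rw [Ebar_of_mem h0]
    exact (ENNReal.ofReal_lt_ofReal_iff (by linarith)).2 (by linarith)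
  refine ⟨F.E ⊤ 0 + 1, (eventually_lt_of_limsup_lt hlt).mono fun n hn => ?_⟩
  rw [Ebar_of_mem (hus n).1] at hn
  exact (ENNReal.ofReal_le_ofReal_iff (by linarith)).1 hn.le

end

end Family

/-- Theorem 2.3, convergence of minimizers as `σ → ∞`.
Under Assumptions 1, 2 and 3, for every `σ ∈ (0,∞]` there exists a minimizer
`u_σ ∈ T_σ` of `E_σ` over `T_σ`.  Moreover, for every sequence `σ_n → ∞` and any
choice of minimizers `u_{σ_n} ∈ T_{σ_n}`, there is a subsequence (not relabeled)
and `u_∞ ∈ T_∞` such that `‖u_{σ_n} − u_∞‖_{T_0} → 0` and `u_∞` minimizes `E_∞`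
over `T_∞`. -/
theorem convergence_of_minimizers_sigma_to_inf
    {T0 : Type*} [NormedAddCommGroup T0] [NormedSpace ℝ T0] [CompleteSpace T0]
    (F : Family T0) (p : ℝ) (hp : 1 < p)
    (hB : F.Basic) (h1 : F.A1) (h2 : F.A2 p) (h3 : F.A3) :
    (∀ σ : ℝ≥0∞, 0 < σ → ∃ u ∈ F.S σ, ∀ v ∈ F.S σ, F.E σ u ≤ F.E σ v) ∧
    ∀ σs : ℕ → ℝ≥0∞, ToInf σs → ∀ us : ℕ → T0,
      (∀ n, us n ∈ F.S (σs n) ∧ ∀ v ∈ F.S (σs n), F.E (σs n) (us n) ≤ F.E (σs n) v) →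
      ∃ (φ : ℕ → ℕ) (uinf : T0), StrictMono φ ∧ uinf ∈ F.S ⊤ ∧
        Tendsto (fun n => us (φ n)) atTop (𝓝 uinf) ∧
        ∀ v ∈ F.S ⊤, F.E ⊤ uinf ≤ F.E ⊤ v := by
  refine ⟨fun σ hσ => Family.exists_minimizer hp hB h2 hσ, fun σs hσs us hus => ?_⟩
  obtain ⟨M, hM⟩ := h3.exists_eventually_energy_le hB hσs hus
  obtain ⟨k, hk⟩ := eventually_atTop.1 hM
  obtain ⟨C, hC⟩ := h2.exists_norm_le_of_energy_le hp M
  have hshift : StrictMono fun n : ℕ => n + k := fun _ _ h => Nat.add_lt_add_right h k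
  obtain ⟨⟨w, φ, hφ, hlim⟩, hmem⟩ := h1.compact _ (hσs.comp_strictMono hshift)
    (fun n => us (n + k)) (fun n => (hus (n + k)).1)
    ⟨C, fun n => hC _ (hσs.1 _).1 _ (hus (n + k)).1 (hk _ (Nat.le_add_left k n))⟩
  have hw : w ∈ F.S ⊤ := hmem w φ hφ hlim
  exact ⟨fun n => φ n + k, w, hshift.comp hφ, hw, hlim,
    h3.minimizer_of_tendsto hB (hσs.comp_strictMono (hshift.comp hφ))
      (us := fun n => us (φ n + k)) (fun n => hus (φ n + k)) hw hlim⟩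
end
end

section
/- Assumption 4' implies Assumption 4. That is, suppose: (i) T_∞ ⊆ T_σ for all σ ∈ (0,∞) and there is M2 > 0 independent of σ with ‖u‖_{T_σ} ≤ M2‖u‖_{T_∞} for all u ∈ T_∞; (ii) for each h ∈ (0,h0], W_{∞,h} = T_∞ ∩ W_{σ,h} for every σ ∈ (0,∞]; (iii) for each σ ∈ (0,∞] and each u ∈ T_σ there are h_n → 0 and u_n ∈ W_{σ,h_n} with ‖u − u_n‖_{T_σ} → 0; (iv) E_∞(v) = lim_n E_{σ_n}(v) for every v ∈ T_∞ and every sequence σ_n → ∞; (v) for every v ∈ T_∞ and every sequence σ_n → ∞, h_n → 0 there exist v_n ∈ W_{σ_n,h_n} with ‖v_n − v‖_{T_∞} → 0. Then Assumption 4 holds, namely: (i) for each σ ∈ (0,∞] and each u ∈ T_σ there are h_n → 0 and u_n ∈ W_{σ,h_n} with ‖u − u_n‖_{T_σ} → 0; (ii) for each h, W_{∞,h} = T_∞ ∩ ∪_{σ∈(0,∞]} W_{σ,h}; (iii) setting W_{∞,0} := T_∞, for every h ∈ {0} ∪ (0,h0], every v ∈ W_{∞,h}, and every sequence (σ_n,h_n)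 with σ_n → ∞ and (h_n = h for all n if h > 0; h_n → 0 if h = 0), there exist v_{σ_n} ∈ T_{σ_n} with ‖v_{σ_n} − v‖_{T0} → 0 and E_{σ_n}(v_{σ_n}) → E_∞(v), and v_n ∈ W_{σ_n,h_n} with ‖v_n − v_{σ_n}‖_{T_{σ_n}} → 0. -/
open Filter Topology ENNReal

noncomputable section

variable {T0 : Type*} [NormedAddCommGroup T0] [NormedSpace ℝ T0] [CompleteSpace T0]

namespace Family

variable {T0 : Type*} [NormedAddCommGroup T0] [NormedSpace ℝ T0] [CompleteSpace T0]
variable (F : Family T0)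

/-- Assumption 4′: (i) `T_∞ ⊆ T_σ` with a uniform embedding constant `M2`;
(ii) `W_{∞,h} = T_∞ ∩ W_{σ,h}` for every `σ ∈ (0,∞]`; (iii) the approximation
property of the `W_{σ,h}` in each `T_σ`; (iv) pointwise convergence
`E_{σ_n}(v) → E_∞(v)` on `T_∞`; (v) asymptotic density of the `W_{σ,h}` in `T_∞`. -/
structure A4' (W : ℝ≥0∞ → ℝ → Set T0) (h0 : ℝ) : Prop where
  embed : ∃ M2 : ℝ, 0 < M2 ∧ ∀ σ : ℝ≥0∞, 0 < σ → σ ≠ ⊤ →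
    F.S ⊤ ⊆ F.S σ ∧ ∀ u ∈ F.S ⊤, F.N σ u ≤ M2 * F.N ⊤ u
  limitSpace : ∀ h ∈ Set.Ioc (0 : ℝ) h0, ∀ σ : ℝ≥0∞, 0 < σ →
    W ⊤ h = F.S ⊤ ∩ W σ h
  approx : ∀ σ : ℝ≥0∞, 0 < σ → ∀ u ∈ F.S σ, ∃ (hs : ℕ → ℝ) (us : ℕ → T0),
    (∀ n, hs n ∈ Set.Ioc (0 : ℝ) h0) ∧ Tendsto hs atTop (𝓝 0) ∧
    (∀ n, us n ∈ W σ (hs n)) ∧ Tendsto (fun n => F.N σ (u - us n)) atTop (𝓝 0)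
  ptwise : ∀ v ∈ F.S ⊤, ∀ σs : ℕ → ℝ≥0∞, ToInf σs →
    Tendsto (fun n => F.E (σs n) v) atTop (𝓝 (F.E ⊤ v))
  dense : ∀ v ∈ F.S ⊤, ∀ (σs : ℕ → ℝ≥0∞) (hs : ℕ → ℝ), ToInf σs →
    (∀ n, hs n ∈ Set.Ioc (0 : ℝ) h0) → Tendsto hs atTop (𝓝 0) →
    ∃ vs : ℕ → T0, (∀ n, vs n ∈ W (σs n) (hs n) ∧ vs n ∈ F.S ⊤) ∧
      Tendsto (fun n => F.N ⊤ (vs n - v)) atTop (𝓝 0)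

end Family

/-- Lemma 2.5: Assumption 4′ implies Assumption 4. -/
theorem assumption4'_implies_assumption4
    {T0 : Type*} [NormedAddCommGroup T0] [NormedSpace ℝ T0] [CompleteSpace T0]
    (F : Family T0) (W : ℝ≥0∞ → ℝ → Set T0) (h0 : ℝ)
    (hB : F.Basic) (hFE : F.FEBasic W h0)
    (h4' : F.A4' W h0) : F.A4 W h0 := by
  obtain ⟨M2, -, hM2⟩ := h4'.embed
  have hsub : ∀ σ : ℝ≥0∞, 0 < σ → σ ≠ ⊤ → F.S ⊤ ⊆ F.S σ := fun σ hpos htop =>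
    (hM2 σ hpos htop).1
  refine ⟨h4'.approx, fun h hh => ?_, fun h hh v hv σs hσ => ?_, fun v hv σs hs hσ hhs hs0 => ?_⟩
  · ext v
    simp only [Set.mem_inter_iff, Set.mem_iUnion, Set.mem_Ioi, exists_prop]
    constructor
    · intro hv
      exact ⟨hFE.subset ⊤ ENNReal.zero_lt_top h hh hv, ⊤, ENNReal.zero_lt_top, hv⟩
    · rintro ⟨hv, σ, hσ, hvσ⟩
      rw [h4'.limitSpace h hh σ hσ]
      exact ⟨hv, hvσ⟩
  · have hvS := hFE.subset ⊤ ENNReal.zero_lt_top h hh hv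
    refine ⟨fun _ => v, fun n => hsub _ (hσ.1 n).1 (hσ.1 n).2 hvS, tendsto_const_nhds,
      h4'.ptwise v hvS σs hσ, fun _ => v, fun n => ?_, ?_⟩
    · rw [h4'.limitSpace h hh (σs n) (hσ.1 n).1] at hv
      exact hv.2
    · have hN : ∀ n, F.N (σs n) (v - v) = 0 := fun n => by
        have hn := hB.normed (σs n) (hσ.1 n).1
        simpa using hn.norm_smul 0 0 hn.zero_mem
      simp only [hN, tendsto_const_nhds]
  · obtain ⟨ws, hws, hlim⟩ := h4'.dense v hv σs hs hσ hhs hs0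
    have hT := hB.normed ⊤ ENNReal.zero_lt_top
    have hd : ∀ n, ws n - v ∈ F.S ⊤ := fun n => by
      have := hT.add_mem _ _ (hws n).2 (hT.smul_mem (-1) v hv)
      simpa [sub_eq_add_neg] using this
    refine ⟨fun _ => v, fun n => hsub _ (hσ.1 n).1 (hσ.1 n).2 hv, tendsto_const_nhds,
      h4'.ptwise v hv σs hσ, ws, fun n => (hws n).1, ?_⟩
    refine squeeze_zero (fun n => ?_) (fun n => ?_) (by simpa using hlim.const_mul M2)
    · exact (hB.normed _ (hσ.1 n).1).nonneg _ (hsub _ (hσ.1 n).1 (hσ.1 n).2 (hd n))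
    · exact (hM2 _ (hσ.1 n).1 (hσ.1 n).2).2 _ (hd n)
end
end

section
/- Under Assumptions 1, 2, 3 and 4, let σ_n → ∞ and h_n → 0 be arbitrary sequences. Then the restricted functionals E_{σ_n,h_n} Γ-converge as n → ∞ in the T0-norm topology to Ē_∞; that is: (liminf) for every v ∈ T0 and every sequence v_n with ‖v_n − v‖_{T0} → 0, one has Ē_∞(v) ≤ liminf_n E_{σ_n,h_n}(v_n); and (recovery) for every v ∈ T0 there exist v_n with ‖v_n − v‖_{T0} → 0 and limsup_n E_{σ_n,h_n}(v_n) ≤ Ē_∞(v). -/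
open Filter Topology ENNReal

noncomputable section

variable {T0 : Type*} [NormedAddCommGroup T0] [NormedSpace ℝ T0] [CompleteSpace T0]

/-- Enlarging the domain decreases the extended energy. -/
lemma Ebar_anti {X : Type*} {S S' : Set X} (hSS' : S ⊆ S') (E : X → ℝ) (u : X) :
    Ebar S' E u ≤ Ebar S E u := by
  by_cases hu : u ∈ S
  · simp [Ebar, hu, hSS' hu]
  · simp [Ebar, hu]

/-- A term of order below `t ^ p` cannot compensate for `α * t ^ p`: the inequality
`α * t ^ p ≤ C + ψ t` bounds `t`. -/
lemma exists_bound_of_mul_rpow_le {p α : ℝ} (hp : 0 < p) (hα : 0 < α) {ψ : ℝ → ℝ}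
    (hψ : Tendsto (fun t => ψ t / t ^ p) atTop (𝓝 0)) (C : ℝ) :
    ∃ R : ℝ, ∀ t : ℝ, α * t ^ p ≤ C + ψ t → t ≤ R := by
  have hsmall : ∀ᶠ t : ℝ in atTop, ψ t / t ^ p < α / 2 :=
    hψ.eventually_lt_const (half_pos hα)
  have hlarge : ∀ᶠ t : ℝ in atTop, 2 * C / α < t ^ p :=
    (tendsto_rpow_atTop hp).eventually_gt_atTop _
  obtain ⟨R, hR⟩ := eventually_atTop.1 (hsmall.and (hlarge.and (eventually_gt_atTop 0)))
  refine ⟨R, fun t ht => ?_⟩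
  by_contra! htR
  obtain ⟨hψt, hCt, ht0⟩ := hR t htR.le
  rw [div_lt_iff₀ (Real.rpow_pos_of_pos ht0 p)] at hψt
  rw [div_lt_iff₀ hα] at hCt
  nlinarith

lemma IsNormedSubspace.sub_mem {X : Type*} [NormedAddCommGroup X] [NormedSpace ℝ X]
    {S : Set X} {N : X → ℝ} (hS : IsNormedSubspace S N) {u v : X} (hu : u ∈ S) (hv : v ∈ S) :
    u - v ∈ S := by
  simpa [sub_eq_add_neg] using hS.add_mem _ _ hu (hS.smul_mem (-1) _ hv)

namespace Family

/-- Uniform coercivity: bounded energies force bounded norms. -/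
lemma A2.exists_norm_bound {X : Type*} [NormedAddCommGroup X] [NormedSpace ℝ X]
    {F : Family X} {p : ℝ} (hp : 0 < p) (h2 : F.A2 p) (C : ℝ) :
    ∃ R : ℝ, ∀ σ : ℝ≥0∞, 0 < σ → ∀ u ∈ F.S σ, F.E σ u ≤ C → F.N σ u ≤ R := by
  obtain ⟨α, hα, ψ, -, hψ, hcoer⟩ := h2.coercive
  obtain ⟨R, hR⟩ := exists_bound_of_mul_rpow_le hp hα hψ C
  exact ⟨R, fun σ hσ u hu hE => hR _ ((hcoer σ hσ u hu).trans (by gcongr))⟩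

/-- On bounded sets the energies are Lipschitz, uniformly in the parameter. -/
lemma A2.exists_lipschitz {X : Type*} [NormedAddCommGroup X] [NormedSpace ℝ X]
    {F : Family X} {p : ℝ} (hB : F.Basic) (h2 : F.A2 p) (R : ℝ) :
    ∃ L : ℝ, ∀ σ : ℝ≥0∞, 0 < σ → ∀ u ∈ F.S σ, ∀ v ∈ F.S σ, F.N σ u ≤ R → F.N σ v ≤ R →
      |F.E σ u - F.E σ v| ≤ L * F.N σ (u - v) := by
  obtain ⟨φ, hφ, hlip⟩ := h2.continuity
  obtain ⟨L, hL⟩ := ((isCompact_Icc (a := (0 : ℝ)) (b := R)).prod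
    (isCompact_Icc (a := (0 : ℝ)) (b := R))).bddAbove_image hφ.continuousOn
  refine ⟨L, fun σ hσ u hu v hv huR hvR => (hlip σ hσ u hu v hv).trans ?_⟩
  have hnonneg := (hB.normed σ hσ).nonneg
  exact mul_le_mul_of_nonneg_right
    (hL ⟨(F.N σ u, F.N σ v), ⟨⟨hnonneg u hu, huR⟩, ⟨hnonneg v hv, hvR⟩⟩, rfl⟩)
    (hnonneg _ ((hB.normed σ hσ).sub_mem hu hv))

/-- Along a sequence of bounded energy, a perturbation that is small in the
parameter-dependent norms does not change the limit of the energies. -/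
lemma tendsto_energy_of_perturbation {X : Type*} [NormedAddCommGroup X] [NormedSpace ℝ X]
    {F : Family X} {p : ℝ} (hp : 0 < p) (hB : F.Basic)
    (h2 : F.A2 p) {σs : ℕ → ℝ≥0∞} (hσs : ∀ n, 0 < σs n) {vs ws : ℕ → X}
    (hvs : ∀ n, vs n ∈ F.S (σs n)) (hws : ∀ n, ws n ∈ F.S (σs n))
    {e : ℝ}
    (hE : Tendsto (fun n => F.E (σs n) (vs n)) atTop (𝓝 e))
    (hN : Tendsto (fun n => F.N (σs n) (ws n - vs n)) atTop (𝓝 0)) :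
    Tendsto (fun n => F.E (σs n) (ws n)) atTop (𝓝 e) := by
  have hsub : ∀ n, ws n - vs n ∈ F.S (σs n) :=
    fun n => (hB.normed _ (hσs n)).sub_mem (hws n) (hvs n)
  obtain ⟨C, hC⟩ := hE.bddAbove_range
  obtain ⟨D, hD⟩ := hN.bddAbove_range
  obtain ⟨R, hR⟩ := A2.exists_norm_bound hp h2 C
  have hD0 : 0 ≤ D := ((hB.normed _ (hσs 0)).nonneg _ (hsub 0)).trans (hD ⟨0, rfl⟩)
  obtain ⟨L, hL⟩ := A2.exists_lipschitz hB h2 (D + R)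
  have hvR : ∀ n, F.N (σs n) (vs n) ≤ R := fun n => hR _ (hσs n) _ (hvs n) (hC ⟨n, rfl⟩)
  have hwR : ∀ n, F.N (σs n) (ws n) ≤ D + R := fun n => by
    have htri := (hB.normed _ (hσs n)).triangle _ (hsub n) _ (hvs n)
    rw [sub_add_cancel] at htri
    exact htri.trans (add_le_add (hD ⟨n, rfl⟩) (hvR n))
  have hdiff : Tendsto (fun n => F.E (σs n) (ws n) - F.E (σs n) (vs n)) atTop (𝓝 0) :=
    squeeze_zero_norm
      (fun n => hL _ (hσs n) _ (hws n) _ (hvs n) (hwR n) (by linarith [hvR n]))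
      (by simpa using hN.const_mul L)
  simpa using hdiff.add hE

/-- Convergence to zero in the parameter-dependent norms implies convergence in the ambient space. -/
lemma A1.tendsto_zero {X : Type*} [NormedAddCommGroup X] [NormedSpace ℝ X]
    {F : Family X} (h1 : F.A1) {σs : ℕ → ℝ≥0∞} (hσs : ∀ n, 0 < σs n)
    {us : ℕ → X} (hus : ∀ n, us n ∈ F.S (σs n))
    (hN : Tendsto (fun n => F.N (σs n) (us n)) atTop (𝓝 0)) :
    Tendsto us atTop (𝓝 0) := by
  obtain ⟨M1, hM1, hemb⟩ := h1.embed
  refine squeeze_zero_norm (fun n => ?_) (by simpa using hN.div_const M1)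
  rw [le_div_iff₀ hM1, mul_comm]
  exact hemb _ (hσs n) _ (hus n)

end Family

/-- Theorem 2.9, convergence as `σ → ∞` and `h → 0`:
under Assumptions 1, 2, 3 and 4, for arbitrary sequences `σ_n → ∞` and
`h_n → 0`, the restricted functionals `E_{σ_n,h_n}` Γ-converge, as `n → ∞` and
in the norm topology of `T0`, to `Ē_∞`. -/
theorem gamma_convergence_ac
    {T0 : Type*} [NormedAddCommGroup T0] [NormedSpace ℝ T0] [CompleteSpace T0]
    (F : Family T0) (W : ℝ≥0∞ → ℝ → Set T0) (p h0 : ℝ) (hp : 1 < p)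
    (hB : F.Basic) (h1 : F.A1) (h2 : F.A2 p) (h3 : F.A3)
    (hFE : F.FEBasic W h0) (h4 : F.A4 W h0)
    (σs : ℕ → ℝ≥0∞) (hσs : ToInf σs)
    (hs : ℕ → ℝ) (hhs : ∀ n, hs n ∈ Set.Ioc (0 : ℝ) h0)
    (hhs0 : Tendsto hs atTop (𝓝 0)) :
    (∀ (v : T0) (vs : ℕ → T0), Tendsto vs atTop (𝓝 v) →
      Ebar (F.S ⊤) (F.E ⊤) v ≤
        Filter.liminf (fun n => Ebar (W (σs n) (hs n)) (F.E (σs n)) (vs n)) atTop) ∧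
    ∀ v : T0, ∃ vs : ℕ → T0, Tendsto vs atTop (𝓝 v) ∧
      Filter.limsup (fun n => Ebar (W (σs n) (hs n)) (F.E (σs n)) (vs n)) atTop ≤
        Ebar (F.S ⊤) (F.E ⊤) v := by
  refine ⟨fun v vs hvs => (h3.liminf_le v σs hσs vs hvs).trans (liminf_le_liminf
    (.of_forall fun n => Ebar_anti (hFE.subset _ (hσs.1 n).1 _ (hhs n)) _ _)), fun v => ?_⟩
  by_cases hv : v ∈ F.S ⊤
  · obtain ⟨vs, hvS, hvs, hE, ws, hwW, hN⟩ := h4.asympApprox_zero v hv σs hs hσs hhs hhs0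
    have hσ : ∀ n, 0 < σs n := fun n => (hσs.1 n).1
    have hwS : ∀ n, ws n ∈ F.S (σs n) := fun n => hFE.subset _ (hσ n) _ (hhs n) (hwW n)
    have hsub : ∀ n, ws n - vs n ∈ F.S (σs n) :=
      fun n => (hB.normed _ (hσ n)).sub_mem (hwS n) (hvS n)
    refine ⟨ws, by simpa using (h1.tendsto_zero hσ hsub hN).add hvs, ?_⟩
    have hEw := Family.tendsto_energy_of_perturbation (by linarith) hB h2 hσ hvS hwS hE hN
    simpa [Ebar, hv, hwW] using (ENNReal.tendsto_ofReal hEw).limsup_eq.le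
  · exact ⟨fun _ => v, tendsto_const_nhds, by simp [Ebar, hv]⟩
end
end

section
/- Let p ∈ [2,∞) and define Φ_p : ℝ → ℝ by Φ_p(t) = |t|^{p−2} t. There exists a constant C > 0 depending only on p such that for all s, t ∈ ℝ: |Φ_p(s) − Φ_p(t)| ≤ C |(Φ_p(s) − Φ_p(t))(s − t)|^{1/2} (|s| + |t|)^{(p−2)/2}, and |s − t| ≤ C |(Φ_p(s) − Φ_p(t))(s − t)|^{1/p}. -/
noncomputable section

/-- `Φ_p(t) = |t|^{p-2} t` (with `Φ_p(0) = 0`). -/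
def PhiP (p t : ℝ) : ℝ := |t| ^ (p - 2) * t

/-- Bernoulli's inequality in homogeneous form. -/
lemma rpow_sub_rpow_mul_le {q x y : ℝ} (hq : 0 ≤ q) (hy : 0 ≤ y) (hyx : y ≤ x) :
    (x ^ q - y ^ q) * y ≤ q * x ^ q * (x - y) := by
  rcases hy.eq_or_lt with rfl | hy
  · have := Real.rpow_nonneg hyx q
    simp only [mul_zero, sub_zero]
    positivity
  have hx : 0 < x := hy.trans_le hyx
  have hb := one_add_mul_self_le_rpow_one_add (s := y / x - 1) (p := q + 1)
    (by linarith [div_pos hy hx]) (by linarith)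
  rw [add_sub_cancel, Real.rpow_add_one (by positivity), Real.div_rpow hy.le hx.le] at hb
  have hxq : 0 < x ^ q := Real.rpow_pos_of_pos hx q
  have h := mul_le_mul_of_nonneg_left hb (mul_pos hxq hx).le
  have h₁ : x ^ q * x * (1 + (q + 1) * (y / x - 1)) = x ^ q * (x + (q + 1) * (y - x)) := by
    field_simp
  have h₂ : x ^ q * x * (y ^ q / x ^ q * (y / x)) = y ^ q * y := by
    field_simp
  rw [h₁, h₂] at h
  nlinarith

lemma abs_phiP_sub_le {p : ℝ} (hp : 2 ≤ p) (s t : ℝ) :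
    |PhiP p s - PhiP p t| ≤ (p - 1) * (|s| + |t|) ^ (p - 2) * |s - t| := by
  wlog hts : |t| ≤ |s| generalizing s t
  · rw [abs_sub_comm, abs_sub_comm s, add_comm |s|]
    exact this t s (le_of_not_ge hts)
  have hq : 0 ≤ p - 2 := by linarith
  have hmono : |t| ^ (p - 2) ≤ |s| ^ (p - 2) := Real.rpow_le_rpow (abs_nonneg t) hts hq
  have hs : 0 ≤ |s| ^ (p - 2) := by positivity
  have hle : |s| ^ (p - 2) ≤ (|s| + |t|) ^ (p - 2) :=
    Real.rpow_le_rpow (abs_nonneg s) (by linarith [abs_nonneg t]) hq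
  calc |PhiP p s - PhiP p t|
      = |(|s| ^ (p - 2)) * (s - t) + (|s| ^ (p - 2) - |t| ^ (p - 2)) * t| := by
        unfold PhiP; congr 1; ring
    _ ≤ |s| ^ (p - 2) * |s - t| + (|s| ^ (p - 2) - |t| ^ (p - 2)) * |t| := by
        refine (abs_add_le _ _).trans_eq ?_
        rw [abs_mul, abs_mul, abs_of_nonneg hs, abs_of_nonneg (sub_nonneg.2 hmono)]
    _ ≤ |s| ^ (p - 2) * |s - t| + (p - 2) * |s| ^ (p - 2) * |s - t| := by
        refine add_le_add le_rfl ((rpow_sub_rpow_mul_le hq (abs_nonneg t) hts).trans ?_)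
        gcongr
        exact abs_sub_abs_le_abs_sub s t
    _ = (p - 1) * |s| ^ (p - 2) * |s - t| := by ring
    _ ≤ _ := by gcongr; linarith

lemma abs_sub_rpow_le_phiP_sub_mul {p : ℝ} (hp : 2 ≤ p) (s t : ℝ) :
    |s - t| ^ p ≤ 2 ^ p * ((PhiP p s - PhiP p t) * (s - t)) := by
  wlog hts : |t| ≤ |s| generalizing s t
  · have h := this t s (le_of_not_ge hts)
    rw [abs_sub_comm]
    linarith
  have hq : 0 ≤ p - 2 := by linarith
  have hmono : |t| ^ (p - 2) ≤ |s| ^ (p - 2) := Real.rpow_le_rpow (abs_nonneg t) hts hq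
  have ht : 0 ≤ |t| ^ (p - 2) := by positivity
  have hsplit (x : ℝ) (hx : 0 ≤ x) : x ^ p = x ^ (p - 2) * x ^ 2 := by
    rw [← Real.rpow_natCast x 2, ← Real.rpow_add' hx (by norm_num; linarith)]
    norm_num
  have hdist : |s - t| ^ (p - 2) ≤ 2 ^ (p - 2) * |s| ^ (p - 2) := by
    rw [← Real.mul_rpow zero_le_two (abs_nonneg s)]
    exact Real.rpow_le_rpow (abs_nonneg _) (by linarith [abs_sub s t]) hq
  have hprod : |s| ^ (p - 2) * (s - t) ^ 2 ≤ 2 * ((PhiP p s - PhiP p t) * (s - t)) := by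
    have hsq : 0 ≤ (|s| ^ (p - 2) - |t| ^ (p - 2)) * (s ^ 2 - t ^ 2) :=
      mul_nonneg (sub_nonneg.2 hmono) (sub_nonneg.2 (sq_le_sq.2 hts))
    have := mul_nonneg ht (sq_nonneg (s - t))
    unfold PhiP
    linarith
  have hpos : 0 ≤ (PhiP p s - PhiP p t) * (s - t) := by
    have : 0 ≤ |s| ^ (p - 2) * (s - t) ^ 2 := by positivity
    linarith
  rw [hsplit _ (abs_nonneg _), hsplit 2 zero_le_two, sq_abs]
  calc |s - t| ^ (p - 2) * (s - t) ^ 2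
      ≤ 2 ^ (p - 2) * |s| ^ (p - 2) * (s - t) ^ 2 := by gcongr
    _ = 2 ^ (p - 2) * (|s| ^ (p - 2) * (s - t) ^ 2) := by ring
    _ ≤ 2 ^ (p - 2) * (2 * ((PhiP p s - PhiP p t) * (s - t))) := by gcongr
    _ ≤ 2 ^ (p - 2) * (2 ^ 2 * ((PhiP p s - PhiP p t) * (s - t))) := by gcongr; norm_num
    _ = _ := by ring

/-- for `p ∈ [2,∞)` there is `C > 0` depending only on `p`
such that for all `s, t ∈ ℝ`:
`|Φ_p(s) − Φ_p(t)| ≤ C |(Φ_p(s) − Φ_p(t))(s − t)|^{1/2} (|s| + |t|)^{(p−2)/2}` and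
`|s − t| ≤ C |(Φ_p(s) − Φ_p(t))(s − t)|^{1/p}`. -/
theorem phiP_estimates_p_ge_two (p : ℝ) (hp : 2 ≤ p) :
    ∃ C : ℝ, 0 < C ∧ ∀ s t : ℝ,
      |PhiP p s - PhiP p t| ≤
        C * |(PhiP p s - PhiP p t) * (s - t)| ^ ((1 : ℝ) / 2) *
          (|s| + |t|) ^ ((p - 2) / 2) ∧
      |s - t| ≤ C * |(PhiP p s - PhiP p t) * (s - t)| ^ (1 / p) := by
  refine ⟨p, by linarith, fun s t => ⟨?_, ?_⟩⟩
  · set D := PhiP p s - PhiP p t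
    have hS : 0 ≤ |s| + |t| := by positivity
    refine abs_le_of_sq_le_sq ?_ (by positivity)
    have hX : (|D * (s - t)| ^ ((1 : ℝ) / 2)) ^ 2 = |D * (s - t)| := by
      rw [← Real.rpow_mul_natCast (abs_nonneg _)]; norm_num
    have hSq : ((|s| + |t|) ^ ((p - 2) / 2)) ^ 2 = (|s| + |t|) ^ (p - 2) := by
      rw [← Real.rpow_mul_natCast hS]; norm_num
    rw [mul_pow, mul_pow, hX, hSq, abs_mul]
    calc D ^ 2 = |D| * |D| := by rw [← sq, sq_abs]
      _ ≤ |D| * ((p - 1) * (|s| + |t|) ^ (p - 2) * |s - t|) := by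
          gcongr; exact abs_phiP_sub_le hp s t
      _ = (p - 1) * (|D| * |s - t|) * (|s| + |t|) ^ (p - 2) := by ring
      _ ≤ p ^ 2 * (|D| * |s - t|) * (|s| + |t|) ^ (p - 2) := by gcongr; nlinarith
  · have hp0 : 0 < p := by linarith
    set X := (PhiP p s - PhiP p t) * (s - t)
    have h : |s - t| ^ p ≤ 2 ^ p * |X| :=
      (abs_sub_rpow_le_phiP_sub_mul hp s t).trans (by gcongr; exact le_abs_self _)
    have h' := Real.rpow_le_rpow (by positivity) h (by positivity : 0 ≤ 1 / p)
    rw [Real.mul_rpow (by positivity) (abs_nonneg _), one_div,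
      Real.rpow_rpow_inv (abs_nonneg _) hp0.ne', Real.rpow_rpow_inv zero_le_two hp0.ne'] at h'
    rw [one_div]
    exact h'.trans (by gcongr)
end
end

section
/- Let p ∈ (1,2) and define Φ_p : ℝ → ℝ by Φ_p(t) = |t|^{p−2} t. There exists a constant C > 0 depending only on p such that for all s, t ∈ ℝ: |Φ_p(s) − Φ_p(t)| ≤ C |(Φ_p(s) − Φ_p(t))(s − t)|^{(p−1)/p}, and |s − t| ≤ C |(Φ_p(s) − Φ_p(t))(s − t)|^{1/2} (|s|^{2−p} + |t|^{2−p})^{1/2}. -/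
noncomputable section

theorem PhiP_neg (p t : ℝ) : PhiP p (-t) = -PhiP p t := by
  simp [PhiP]

theorem PhiP_of_nonneg {p t : ℝ} (hp : 1 < p) (ht : 0 ≤ t) : PhiP p t = t ^ (p - 1) := by
  rcases ht.eq_or_lt with rfl | ht
  · simp [PhiP, Real.zero_rpow (sub_pos.2 hp).ne']
  · rw [PhiP, abs_of_pos ht, ← Real.rpow_add_one ht.ne']
    congr 1
    ring

/-- A symmetric relation on `ℝ` invariant under negation holds everywhere as soon as it holds for
ordered pairs of nonnegative numbers and for pairs of opposite signs. -/
theorem forall_real_of_symm_of_neg {P : ℝ → ℝ → Prop} (symm : ∀ s t, P s t → P t s)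
    (neg : ∀ s t, P s t → P (-s) (-t)) (same : ∀ s t, 0 ≤ t → t ≤ s → P s t)
    (opp : ∀ s u, 0 ≤ s → 0 ≤ u → P s (-u)) (s t : ℝ) : P s t := by
  rcases le_total 0 s with hs | hs <;> rcases le_total 0 t with ht | ht
  · rcases le_total t s with h | h
    · exact same s t ht h
    · exact symm _ _ (same t s hs h)
  · simpa using opp s (-t) hs (neg_nonneg.2 ht)
  · simpa using symm _ _ (opp t (-s) ht (neg_nonneg.2 hs))
  · rcases le_total t s with h | h
    · simpa using neg _ _ (symm _ _ (same (-t) (-s) (neg_nonneg.2 hs) (neg_le_neg h)))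
    · simpa using neg _ _ (same (-s) (-t) (neg_nonneg.2 ht) (neg_le_neg h))

/-- `Φ_p` is Hölder continuous of exponent `p - 1`. -/
theorem abs_PhiP_sub_le {p : ℝ} (hp1 : 1 < p) (hp2 : p < 2) (s t : ℝ) :
    |PhiP p s - PhiP p t| ≤ 2 * |s - t| ^ (p - 1) := by
  have hq : 0 < p - 1 := by linarith
  refine forall_real_of_symm_of_neg
    (P := fun s t ↦ |PhiP p s - PhiP p t| ≤ 2 * |s - t| ^ (p - 1)) ?_ ?_ ?_ ?_ s t
  · intro s t h
    rwa [abs_sub_comm, abs_sub_comm t]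
  · intro s t h
    rwa [PhiP_neg, PhiP_neg, neg_sub_neg, neg_sub_neg, abs_sub_comm, abs_sub_comm t]
  · intro s t ht hts
    have hs := ht.trans hts
    have hd : 0 ≤ s - t := sub_nonneg.2 hts
    rw [PhiP_of_nonneg hp1 hs, PhiP_of_nonneg hp1 ht, abs_of_nonneg hd,
      abs_of_nonneg (sub_nonneg.2 (Real.rpow_le_rpow ht hts hq.le))]
    have h := Real.rpow_add_le_add_rpow hd ht hq.le (by linarith : p - 1 ≤ 1)
    rw [sub_add_cancel] at h
    have := Real.rpow_nonneg hd (p - 1)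
    linarith
  · intro s u hs hu
    rw [PhiP_neg, PhiP_of_nonneg hp1 hs, PhiP_of_nonneg hp1 hu, sub_neg_eq_add, sub_neg_eq_add,
      abs_of_nonneg (by positivity), abs_of_nonneg (by positivity)]
    have h1 := Real.rpow_le_rpow hs (by linarith : s ≤ s + u) hq.le
    have h2 := Real.rpow_le_rpow hu (by linarith : u ≤ s + u) hq.le
    linarith

/-- Quantitative monotonicity of `Φ_p`. -/
theorem mul_abs_sub_le_abs_PhiP_sub_mul {p : ℝ} (hp1 : 1 < p) (hp2 : p < 2) (s t : ℝ) :
    (p - 1) * |s - t| ≤ |PhiP p s - PhiP p t| * (|s| ^ (2 - p) + |t| ^ (2 - p)) := by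
  have hq : 0 < p - 1 := by linarith
  have split {x : ℝ} (hx : 0 ≤ x) : x ^ (p - 1) * x ^ (2 - p) = x := by
    rw [← Real.rpow_add' hx (by norm_num)]
    norm_num
  refine forall_real_of_symm_of_neg (P := fun s t ↦
    (p - 1) * |s - t| ≤ |PhiP p s - PhiP p t| * (|s| ^ (2 - p) + |t| ^ (2 - p))) ?_ ?_ ?_ ?_ s t
  · intro s t h
    rwa [abs_sub_comm, abs_sub_comm (PhiP p t), add_comm]
  · intro s t h
    rwa [PhiP_neg, PhiP_neg, neg_sub_neg, neg_sub_neg, abs_sub_comm, abs_sub_comm (PhiP p t),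
      abs_neg, abs_neg]
  · intro s t ht hts
    have hs := ht.trans hts
    have hmono := sub_nonneg.2 (Real.rpow_le_rpow ht hts hq.le)
    rw [PhiP_of_nonneg hp1 hs, PhiP_of_nonneg hp1 ht, abs_of_nonneg (sub_nonneg.2 hts),
      abs_of_nonneg hmono, abs_of_nonneg hs, abs_of_nonneg ht]
    have amgm := Real.geom_mean_le_arith_mean2_weighted hq.le (sub_pos.2 hp2).le ht hs (by ring)
    have := mul_nonneg hmono (Real.rpow_nonneg ht (2 - p))
    linarith [split hs]
  · intro s u hs hu
    rw [PhiP_neg, PhiP_of_nonneg hp1 hs, PhiP_of_nonneg hp1 hu, sub_neg_eq_add, sub_neg_eq_add,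
      abs_of_nonneg (by positivity), abs_of_nonneg (by positivity), abs_neg, abs_of_nonneg hs,
      abs_of_nonneg hu]
    have h1 : 0 ≤ s ^ (p - 1) * u ^ (2 - p) := by positivity
    have h2 : 0 ≤ u ^ (p - 1) * s ^ (2 - p) := by positivity
    nlinarith [split hs, split hu]

/-- for `p ∈ (1,2)` there is `C > 0` depending only on `p`
such that for all `s, t ∈ ℝ`:
`|Φ_p(s) − Φ_p(t)| ≤ C |(Φ_p(s) − Φ_p(t))(s − t)|^{(p−1)/p}` and
`|s − t| ≤ C |(Φ_p(s) − Φ_p(t))(s − t)|^{1/2} (|s|^{2−p} + |t|^{2−p})^{1/2}`. -/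
theorem phiP_estimates_p_lt_two (p : ℝ) (hp1 : 1 < p) (hp2 : p < 2) :
    ∃ C : ℝ, 0 < C ∧ ∀ s t : ℝ,
      |PhiP p s - PhiP p t| ≤
        C * |(PhiP p s - PhiP p t) * (s - t)| ^ ((p - 1) / p) ∧
      |s - t| ≤ C * |(PhiP p s - PhiP p t) * (s - t)| ^ ((1 : ℝ) / 2) *
        (|s| ^ (2 - p) + |t| ^ (2 - p)) ^ ((1 : ℝ) / 2) := by
  have hq : 0 < p - 1 := by linarith
  have hp : 0 < p := by linarith
  refine ⟨2 / (p - 1), by positivity, fun s t ↦ ?_⟩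
  have holder := abs_PhiP_sub_le hp1 hp2 s t
  have mono := mul_abs_sub_le_abs_PhiP_sub_mul hp1 hp2 s t
  rw [abs_mul]
  have hD := abs_nonneg (PhiP p s - PhiP p t)
  have hd := abs_nonneg (s - t)
  have hS : 0 ≤ |s| ^ (2 - p) + |t| ^ (2 - p) := by positivity
  generalize |PhiP p s - PhiP p t| = D at *
  generalize |s - t| = d at *
  generalize |s| ^ (2 - p) + |t| ^ (2 - p) = S at *
  have hC : 2 ≤ 2 / (p - 1) := by
    rw [le_div_iff₀ hq]
    linarith
  constructor
  · calc D = D ^ ((p - 1) / p) * D ^ (1 / p) := by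
          have h : (p - 1) / p + 1 / p = 1 := by field_simp; ring
          rw [← Real.rpow_add' hD (by rw [h]; norm_num), h, Real.rpow_one]
      _ ≤ D ^ ((p - 1) / p) * (2 * d ^ (p - 1)) ^ (1 / p) := by gcongr
      _ = 2 ^ (1 / p) * (D * d) ^ ((p - 1) / p) := by
          rw [Real.mul_rpow two_pos.le (by positivity), ← Real.rpow_mul hd, Real.mul_rpow hD hd,
            mul_one_div]
          ring
      _ ≤ 2 / (p - 1) * (D * d) ^ ((p - 1) / p) := by
          gcongr
          refine le_trans ?_ hC
          exact Real.rpow_le_self_of_one_le one_le_two ((div_le_one hp).2 hp1.le)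
  · rw [mul_assoc, ← Real.mul_rpow (by positivity) hS, ← Real.sqrt_eq_rpow]
    refine le_trans (Real.le_sqrt_of_sq_le (y := (2 / (p - 1)) ^ 2 * (D * d * S)) ?_) ?_
    · have h : d ≤ (2 / (p - 1)) ^ 2 * (D * S) := by
        calc d = 1 / (p - 1) * ((p - 1) * d) := by field_simp
          _ ≤ (2 / (p - 1)) ^ 2 * (D * S) := by
            gcongr
            rw [div_pow, div_le_div_iff₀ hq (by positivity)]
            nlinarith
      nlinarith
    · rw [Real.sqrt_mul (by positivity), Real.sqrt_sq (by positivity)]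
end
end
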